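/- Fix integers θ ≥ 2 and k ≥ 1, and let (Y_n)_{n≥0} be the global containment profile process of the hyperrecursive tree with parameter θ, truncated at level k. Then for every i with 1 ≤ i ≤ k, the expected number of vertices contained in exactly i hyperedges satisfies E[Y_{n,i}] = ((θ−1)^{i−1}/θ^{i}) (n+θ) + O((ln n)^{i−1}/n) as n → ∞. -/

import Mathlib

open MeasureTheory Finset Filter Asymptotics

/-- The replacement vector `a_s = (1 − s_1, s_1 − s_2, …, s_{k−1} − s_k, s_k) ∈ ℤ^{k+1}`
of the hyperrecursive-tree urn (0-indexed). -/
def replVecZ (k : ℕ) (s : Fin (k + 1) → ℕ) : Fin (k + 1) → ℤ := fun j =>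
  if j.val = 0 then 1 - (s 0 : ℤ)
  else if j.val = k then (s ⟨k - 1, by omega⟩ : ℤ)
  else (s ⟨j.val - 1, by omega⟩ : ℤ) - (s j : ℤ)

/-- The coefficient of a finite product of power series, indexed by functions. -/
theorem coeff_prod_eq_sum_piAntidiag {ι : Type*} [Fintype ι] [DecidableEq ι]
    (f : ι → PowerSeries ℝ) (m : ℕ) :
    PowerSeries.coeff m (∏ i, f i) =
      ∑ s ∈ piAntidiag univ m, ∏ i, PowerSeries.coeff (s i) (f i) := by
  rw [PowerSeries.coeff_prod]
  refine Finset.sum_bij (fun l _ => ⇑l) ?_ ?_ ?_ ?_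
  · intro l hl
    simpa [Finset.mem_finsuppAntidiag] using hl
  · intro a _ b _ h
    exact DFunLike.coe_injective h
  · intro s hs
    refine ⟨Finsupp.equivFunOnFinite.symm s, ?_, rfl⟩
    simpa [Finset.mem_finsuppAntidiag] using hs
  · intro l _
    rfl

theorem coeff_coe_one_add_X_pow (n m : ℕ) :
    PowerSeries.coeff m (((1 + Polynomial.X) ^ n : Polynomial ℝ) : PowerSeries ℝ) =
      (n.choose m : ℝ) := by
  rw [Polynomial.coeff_coe, Polynomial.coeff_one_add_X_pow]

theorem coeff_coe_natCast_mul_X_mul_one_add_X_pow (n m : ℕ) :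
    PowerSeries.coeff m
      (((n : Polynomial ℝ) * Polynomial.X * (1 + Polynomial.X) ^ (n - 1) : Polynomial ℝ) :
        PowerSeries ℝ) = (m : ℝ) * (n.choose m : ℝ) := by
  rw [Polynomial.coeff_coe]
  have h : (n : Polynomial ℝ) * Polynomial.X * (1 + Polynomial.X) ^ (n - 1) =
      Polynomial.X * Polynomial.derivative ((1 + Polynomial.X) ^ n) := by
    rw [Polynomial.derivative_pow]
    simp
    ring
  rw [h]
  cases m with
  | zero => simp
  | succ m =>
    rw [Polynomial.coeff_X_mul, Polynomial.coeff_derivative, Polynomial.coeff_one_add_X_pow]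
    push_cast
    ring

theorem coe_polynomial_prod {ι : Type*} (u : Finset ι) (f : ι → Polynomial ℝ) :
    ((∏ i ∈ u, f i : Polynomial ℝ) : PowerSeries ℝ) = ∏ i ∈ u, (f i : PowerSeries ℝ) :=
  map_prod (Polynomial.coeToPowerSeries.ringHom (R := ℝ)) f u

/-- The multivariate Vandermonde identity. -/
theorem sum_piAntidiag_prod_choose {ι : Type*} [Fintype ι] [DecidableEq ι]
    (y : ι → ℕ) (m : ℕ) :
    ∑ s ∈ piAntidiag univ m, ∏ i, ((y i).choose (s i) : ℝ) = ((∑ i, y i).choose m : ℝ) := by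
  have h := coeff_prod_eq_sum_piAntidiag
    (fun i => (((1 + Polynomial.X) ^ y i : Polynomial ℝ) : PowerSeries ℝ)) m
  simp only [coeff_coe_one_add_X_pow] at h
  rw [← h, ← coeff_coe_one_add_X_pow, ← Finset.prod_pow_eq_pow_sum, coe_polynomial_prod]

/-- The first moment of the multivariate hypergeometric distribution, before normalisation. -/
theorem sum_piAntidiag_mul_prod_choose {ι : Type*} [Fintype ι] [DecidableEq ι]
    (y : ι → ℕ) (m : ℕ) (j : ι) :
    ((∑ i, y i : ℕ) : ℝ) *
        ∑ s ∈ piAntidiag univ m, (s j : ℝ) * ∏ i, ((y i).choose (s i) : ℝ) =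
      m * y j * ((∑ i, y i).choose m : ℝ) := by
  let f : ι → Polynomial ℝ := fun i =>
    if i = j then (y i : Polynomial ℝ) * Polynomial.X * (1 + Polynomial.X) ^ (y i - 1)
    else (1 + Polynomial.X) ^ y i
  have h := coeff_prod_eq_sum_piAntidiag (fun i => (f i : PowerSeries ℝ)) m
  have hf : ∀ s : ι → ℕ, ∏ i, PowerSeries.coeff (s i) (f i : PowerSeries ℝ) =
      (s j : ℝ) * ∏ i, ((y i).choose (s i) : ℝ) := by
    intro s
    have hterm : ∀ i, PowerSeries.coeff (s i) (f i : PowerSeries ℝ) =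
        (if i = j then (s j : ℝ) else 1) * ((y i).choose (s i) : ℝ) := by
      intro i
      by_cases hi : i = j
      · subst hi
        simp only [f, if_true]
        exact coeff_coe_natCast_mul_X_mul_one_add_X_pow _ _
      · simp only [f, hi, if_false, one_mul]
        exact coeff_coe_one_add_X_pow _ _
    simp_rw [hterm, Finset.prod_mul_distrib]
    simp
  simp_rw [hf] at h
  rw [← h]
  rw [← coe_polynomial_prod]
  rcases Nat.eq_zero_or_pos (y j) with hj | hj
  · have : ∏ i, f i = 0 := Finset.prod_eq_zero (Finset.mem_univ j) (by simp [f, hj])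
    simp [this, hj]
  have hT : 1 ≤ ∑ i, y i :=
    hj.trans_le (Finset.single_le_sum (f := y) (fun _ _ => Nat.zero_le _) (Finset.mem_univ j))
  have hval : ((∑ i, y i : ℕ) : Polynomial ℝ) * ∏ i, f i =
      (y j : Polynomial ℝ) * (((∑ i, y i : ℕ) : Polynomial ℝ) * Polynomial.X *
        (1 + Polynomial.X) ^ (∑ i, y i - 1)) := by
    have h1 : ∏ i, f i = f j * ∏ i ∈ univ.erase j, f i :=
      (Finset.mul_prod_erase _ _ (Finset.mem_univ j)).symm
    have h2 : ∏ i ∈ univ.erase j, f i =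
        (1 + Polynomial.X) ^ ∑ i ∈ univ.erase j, y i := by
      rw [← Finset.prod_pow_eq_pow_sum]
      refine Finset.prod_congr rfl fun i hi => ?_
      simp [f, Finset.ne_of_mem_erase hi]
    have h3 : ∑ i, y i - 1 = (y j - 1) + ∑ i ∈ univ.erase j, y i := by
      have := Finset.add_sum_erase univ y (Finset.mem_univ j)
      omega
    rw [h1, h2, h3, pow_add]
    simp only [f, if_true]
    ring
  have hc := congrArg (fun p : Polynomial ℝ => PowerSeries.coeff m (p : PowerSeries ℝ)) hval
  have hC : ∀ (a : ℕ) (p : Polynomial ℝ),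
      PowerSeries.coeff m (((a : Polynomial ℝ) * p : Polynomial ℝ) : PowerSeries ℝ) =
        a * PowerSeries.coeff m (p : PowerSeries ℝ) := by
    intro a p
    rw [Polynomial.coeff_coe, Polynomial.coeff_coe, ← Polynomial.C_eq_natCast,
      Polynomial.coeff_C_mul]
  rw [hC, hC, coeff_coe_natCast_mul_X_mul_one_add_X_pow] at hc
  rw [hc]
  ring

/-- The error in a cascade of mean recursions is controlled by powers of harmonic numbers. -/
theorem mean_error_bound {t : ℝ} (ht : 2 ≤ t) {k : ℕ} {m : ℕ → ℕ → ℝ}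
    (h_init : ∀ i < k, m 0 i = if i = 0 then t else 0)
    (h_zero : ∀ n : ℕ, m (n + 1) 0 = (1 - (t - 1) / (n + t)) * m n 0 + 1)
    (h_succ : ∀ n i : ℕ, i + 1 < k →
      m (n + 1) (i + 1) = (1 - (t - 1) / (n + t)) * m n (i + 1) + (t - 1) / (n + t) * m n i) :
    ∀ i < k, ∀ n : ℕ, (n + 1) * |m n i - (t - 1) ^ i / t ^ (i + 1) * (n + t)| ≤
      (t - 1) ^ (i + 1) * (1 + (harmonic n : ℝ)) ^ i := by
  have htpos : 0 < t := by linarith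
  have hq : ∀ n : ℕ, ((n : ℝ) + 1 + 1) * (1 - (t - 1) / (n + t)) ≤ n + 1 ∧
      0 ≤ 1 - (t - 1) / (n + t) := by
    intro n
    have hn : (0 : ℝ) ≤ n := n.cast_nonneg
    have hpos : 0 < (n : ℝ) + t := by linarith
    have hsub : 1 - (t - 1) / (n + t) = (n + 1) / (n + t) := by field_simp; ring
    rw [hsub]
    refine ⟨?_, by positivity⟩
    rw [mul_div_assoc', div_le_iff₀ hpos]
    nlinarith
  intro i
  induction i with
  | zero =>
    intro hi n
    simp only [pow_zero, zero_add, pow_one, mul_one]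
    induction n with
    | zero =>
      rw [h_init 0 hi]
      have : (if (0 : ℕ) = 0 then t else 0) - 1 / t * (((0 : ℕ) : ℝ) + t) = t - 1 := by
        simp [htpos.ne']
      rw [this, abs_of_nonneg (by linarith)]
      simp
    | succ n ih =>
      obtain ⟨h1, h2⟩ := hq n
      have hpos : 0 < (n : ℝ) + t := by positivity
      have hrec : m (n + 1) 0 - 1 / t * (((n + 1 : ℕ) : ℝ) + t) =
          (1 - (t - 1) / (n + t)) * (m n 0 - 1 / t * (n + t)) := by
        rw [h_zero]
        push_cast
        field_simp
        ring
      rw [hrec, abs_mul, abs_of_nonneg h2]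
      push_cast
      calc _ = (((n : ℝ) + 1 + 1) * (1 - (t - 1) / (n + t))) * |m n 0 - 1 / t * (n + t)| := by
            ring
        _ ≤ ((n : ℝ) + 1) * |m n 0 - 1 / t * (n + t)| := by gcongr
        _ ≤ _ := ih
  | succ i ihi =>
    intro hi n
    induction n with
    | zero =>
      rw [h_init _ hi]
      simp only [Nat.add_eq_zero_iff, one_ne_zero, and_false, if_false, Nat.cast_zero, zero_add,
        one_mul, zero_sub, abs_neg, harmonic_zero, Rat.cast_zero, add_zero, one_pow, mul_one]
      have h1 : 1 ≤ t - 1 := by linarith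
      rw [abs_of_nonneg (by positivity), pow_succ t (i + 1), ← div_div,
        div_mul_cancel₀ _ htpos.ne']
      calc (t - 1) ^ (i + 1) / t ^ (i + 1) ≤ 1 := by
            rw [div_le_one (by positivity)]
            gcongr
            linarith
        _ ≤ _ := one_le_pow₀ h1
    | succ n ih =>
      obtain ⟨h1, h2⟩ := hq n
      have hi' := ihi (by omega) n
      have hpos : 0 < (n : ℝ) + t := by positivity
      have hn : (0 : ℝ) ≤ n := n.cast_nonneg
      set e := m n (i + 1) - (t - 1) ^ (i + 1) / t ^ (i + 1 + 1) * (n + t) with he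
      set d := m n i - (t - 1) ^ i / t ^ (i + 1) * (n + t) with hd
      set H : ℝ := 1 + (harmonic n : ℝ) with hH
      have hH0 : 0 ≤ H := by
        have : (0 : ℚ) ≤ harmonic n := Finset.sum_nonneg fun _ _ => by positivity
        have : (0 : ℝ) ≤ (harmonic n : ℝ) := by exact_mod_cast this
        positivity
      have hHs : 1 + (harmonic (n + 1) : ℝ) = H + 1 / ((n : ℝ) + 1) := by
        rw [harmonic_succ, hH]
        push_cast
        rw [one_div]
        ring
      have hrec : m (n + 1) (i + 1) -
          (t - 1) ^ (i + 1) / t ^ (i + 1 + 1) * (((n + 1 : ℕ) : ℝ) + t) =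
          (1 - (t - 1) / (n + t)) * e + (t - 1) / (n + t) * d := by
        rw [h_succ n i hi, he, hd]
        push_cast
        field_simp
        ring
      rw [hrec, hHs]
      push_cast
      have ht1 : 0 ≤ t - 1 := by linarith
      have hd1 : ((n : ℝ) + 1 + 1) * ((t - 1) / (n + t)) ≤ t - 1 := by
        rw [mul_div_assoc', div_le_iff₀ hpos]
        nlinarith
      have hd2 : |d| ≤ (t - 1) ^ (i + 1) * H ^ i * (1 / ((n : ℝ) + 1)) := by
        rw [mul_one_div, le_div_iff₀ (by positivity)]
        linarith
      calc ((n : ℝ) + 1 + 1) * |(1 - (t - 1) / (n + t)) * e + (t - 1) / (n + t) * d|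
          ≤ ((n : ℝ) + 1 + 1) * ((1 - (t - 1) / (n + t)) * |e| + (t - 1) / (n + t) * |d|) := by
            gcongr
            refine (abs_add_le _ _).trans_eq ?_
            rw [abs_mul, abs_mul, abs_of_nonneg h2,
              abs_of_nonneg (show 0 ≤ (t - 1) / (n + t) by positivity)]
        _ = (((n : ℝ) + 1 + 1) * (1 - (t - 1) / (n + t))) * |e| +
            (((n : ℝ) + 1 + 1) * ((t - 1) / (n + t))) * |d| := by ring
        _ ≤ ((n : ℝ) + 1) * |e| +
            (t - 1) * ((t - 1) ^ (i + 1) * H ^ i * (1 / ((n : ℝ) + 1))) := by gcongr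
        _ ≤ (t - 1) ^ (i + 1 + 1) * H ^ (i + 1) +
            (t - 1) * ((t - 1) ^ (i + 1) * H ^ i * (1 / ((n : ℝ) + 1))) := by gcongr
        _ = (t - 1) ^ (i + 1 + 1) * (H ^ i * (H + 1 / ((n : ℝ) + 1))) := by ring
        _ ≤ (t - 1) ^ (i + 1 + 1) *
            ((H + 1 / ((n : ℝ) + 1)) ^ i * (H + 1 / ((n : ℝ) + 1))) := by
            gcongr
            exact le_add_of_nonneg_right (by positivity)
        _ = (t - 1) ^ (i + 1 + 1) * (H + 1 / ((n : ℝ) + 1)) ^ (i + 1) := by ring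

theorem isBigO_log_pow_div_of_harmonic_bound {e : ℕ → ℝ} {C : ℝ} {i : ℕ} (hC : 0 ≤ C)
    (h : ∀ n : ℕ, (n + 1) * |e n| ≤ C * (1 + (harmonic n : ℝ)) ^ i) :
    e =O[atTop] fun n : ℕ => Real.log n ^ i / (n : ℝ) := by
  refine IsBigO.of_bound (C * 3 ^ i) ?_
  filter_upwards [eventually_ge_atTop 3] with n hn
  have hn' : (3 : ℝ) ≤ n := by exact_mod_cast hn
  have hnpos : (0 : ℝ) < n := by linarith
  have hlog : 1 ≤ Real.log n := by
    rw [Real.le_log_iff_exp_le hnpos]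
    linarith [Real.exp_one_lt_three]
  have hH := harmonic_le_one_add_log n
  have hH0 : (0 : ℝ) ≤ (harmonic n : ℝ) := by
    have : (0 : ℚ) ≤ harmonic n := Finset.sum_nonneg fun _ _ => by positivity
    exact_mod_cast this
  rw [Real.norm_eq_abs, Real.norm_of_nonneg (by positivity), mul_div_assoc', le_div_iff₀ hnpos]
  calc |e n| * n ≤ (n + 1) * |e n| := by nlinarith [abs_nonneg (e n)]
    _ ≤ C * (1 + (harmonic n : ℝ)) ^ i := h n
    _ ≤ C * (3 * Real.log n) ^ i := by
        gcongr
        linarith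
    _ = C * 3 ^ i * Real.log n ^ i := by rw [mul_pow]; ring

theorem sum_replVecZ {k : ℕ} (hk : 1 ≤ k) (s : Fin (k + 1) → ℕ) : ∑ j, replVecZ k s j = 1 := by
  obtain ⟨l, rfl⟩ : ∃ l, k = l + 1 := ⟨k - 1, by omega⟩
  rw [Fin.sum_univ_succ, Fin.sum_univ_castSucc]
  have h_mid : ∀ j : Fin l, replVecZ (l + 1) s j.castSucc.succ =
      (s j.castSucc.castSucc : ℤ) - s j.succ.castSucc := by
    intro j
    have hj := j.isLt
    simp only [replVecZ, Fin.val_succ, Fin.val_castSucc]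
    rw [if_neg (by omega), if_neg (by omega)]
    congr 3
  have h_last : replVecZ (l + 1) s (Fin.last l).succ = s (Fin.last l).castSucc := by
    simp only [replVecZ, Fin.val_succ, Fin.val_last]
    rw [if_neg (by omega), if_pos trivial]
    congr 2
  have h_first : replVecZ (l + 1) s 0 = 1 - s 0 := by simp [replVecZ]
  simp_rw [h_mid]
  rw [h_last, h_first, Finset.sum_sub_distrib]
  have h1 := Fin.sum_univ_succ fun j : Fin (l + 1) => (s j.castSucc : ℤ)
  have h2 := Fin.sum_univ_castSucc fun j : Fin (l + 1) => (s j.castSucc : ℤ)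
  simp only [Fin.castSucc_zero] at h1
  linarith

theorem replVecZ_injOn {k m : ℕ} {s s' : Fin (k + 1) → ℕ} 
    (hs : ∑ i, s i = m) (hs' : ∑ i, s' i = m) (h : replVecZ k s = replVecZ k s') : s = s' := by
  have hlt : ∀ i (hi : i < k), s ⟨i, by omega⟩ = s' ⟨i, by omega⟩ := by
    intro i
    induction i with
    | zero =>
      intro hi
      have := congrFun h 0
      simp only [replVecZ, Fin.val_zero, if_true] at this
      have h0 : s 0 = s' 0 := by omega
      exact h0
    | succ i ih =>
      intro hi
      have h1 := congrFun h ⟨i + 1, by omega⟩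
      have h2 := ih (by omega)
      simp only [replVecZ, Nat.add_one_ne_zero, if_false, hi.ne, Nat.add_sub_cancel] at h1
      omega
  have hcast : ∀ i : Fin k, s i.castSucc = s' i.castSucc := fun i => hlt i i.isLt
  have hlast : s (Fin.last k) = s' (Fin.last k) := by
    rw [Fin.sum_univ_castSucc] at hs hs'
    simp_rw [hcast] at hs
    omega
  funext i
  exact Fin.lastCases hlast hcast i

theorem sum_ite_transition {k m : ℕ} {y w s₀ : Fin (k + 1) → ℕ}
    (hs₀ : s₀ ∈ piAntidiag univ m) (h : ∀ j, (w j : ℤ) = y j + replVecZ k s₀ j)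
    (g : (Fin (k + 1) → ℕ) → ℝ) :
    ∑ s ∈ piAntidiag univ m, g s *
      (if ∀ j, (w j : ℤ) = (y j : ℤ) + replVecZ k s j then (1 : ℝ) else 0) = g s₀ := by
  rw [Finset.sum_eq_single_of_mem s₀ hs₀, if_pos h, mul_one]
  intro s hs hne
  rw [if_neg, mul_zero]
  intro h'
  apply hne
  refine replVecZ_injOn (m := m) (by simpa using hs) (by simpa using hs₀) ?_
  funext j
  linarith [h j, h' j]

/-- Almost sure form and mean form of one transition with multivariate-hypergeometric law. -/
theorem transition_ae_and_integral {Ω : Type*} {m0 : MeasurableSpace Ω} {μ : Measure Ω}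
    [IsProbabilityMeasure μ] {k m N : ℕ} (hmN : m ≤ N)
    {y w : Ω → Fin (k + 1) → ℕ}
    (hy : Measurable y) (hw : Measurable w) (hsum : ∀ᵐ ω ∂μ, ∑ j, y ω j = N)
    (hcond : ∀ s : Fin (k + 1) → ℕ, ∑ i, s i = m →
      ∫ ω, (if (∀ j : Fin (k + 1), (w ω j : ℤ) = (y ω j : ℤ) + replVecZ k s j)
          then (1 : ℝ) else 0) ∂μ =
        ∫ ω, (∏ j, ((y ω j).choose (s j) : ℝ)) / (N.choose m : ℝ) ∂μ) :
    (∀ᵐ ω ∂μ, ∃ s ∈ piAntidiag univ m, ∀ j, (w ω j : ℤ) = (y ω j : ℤ) + replVecZ k s j) ∧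
    ∀ i, ∫ ω, (w ω i : ℝ) ∂μ = ∫ ω, ((y ω i : ℝ) + ∑ s ∈ piAntidiag univ m,
      (replVecZ k s i : ℝ) * ((∏ j, ((y ω j).choose (s j) : ℝ)) / (N.choose m : ℝ))) ∂μ := by
  set S := piAntidiag (univ : Finset (Fin (k + 1))) m with hS
  set I : (Fin (k + 1) → ℕ) → Ω → ℝ := fun s ω =>
    if (∀ j : Fin (k + 1), (w ω j : ℤ) = (y ω j : ℤ) + replVecZ k s j) then (1 : ℝ) else 0 with hI
  set p : (Fin (k + 1) → ℕ) → Ω → ℝ := fun s ω =>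
    (∏ j, ((y ω j).choose (s j) : ℝ)) / (N.choose m : ℝ) with hp
  have hyj : ∀ j, Measurable fun ω => y ω j := fun j => (measurable_pi_apply j).comp hy
  have hwj : ∀ j, Measurable fun ω => w ω j := fun j => (measurable_pi_apply j).comp hw
  have hImeas : ∀ s, Measurable (I s) := by
    intro s
    refine Measurable.ite ?_ measurable_const measurable_const
    rw [Set.ofPred_forall]
    refine MeasurableSet.iInter fun j => ?_
    have h1 : Measurable fun ω => (w ω j : ℤ) := (measurable_of_countable _).comp (hwj j)
    have h2 : Measurable fun ω => (y ω j : ℤ) + replVecZ k s j :=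
      (measurable_of_countable fun a : ℕ => (a : ℤ) + replVecZ k s j).comp (hyj j)
    exact measurableSet_eq_fun h1 h2
  have hIint : ∀ s, Integrable (I s) μ := by
    intro s
    refine Integrable.of_bound (hImeas s).aestronglyMeasurable 1 (ae_of_all _ fun ω => ?_)
    simp only [hI]
    split_ifs <;> simp
  have hmem : ∀ s ∈ S, ∑ i, s i = m := fun s hs => by simpa [hS] using hs
  have hIp : ∀ s ∈ S, ∫ ω, I s ω ∂μ = ∫ ω, p s ω ∂μ := fun s hs => hcond s (hmem s hs)
  have hchoose : (0 : ℝ) < (N.choose m : ℝ) := by exact_mod_cast Nat.choose_pos hmN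
  have hpsum : ∀ᵐ ω ∂μ, ∑ s ∈ S, p s ω = 1 := by
    filter_upwards [hsum] with ω hω
    simp only [hp]
    rw [← Finset.sum_div, sum_piAntidiag_prod_choose, hω, div_self hchoose.ne']
  have hpint : ∀ s ∈ S, Integrable (p s) μ := by
    intro s hs
    have hpmeas : Measurable (p s) := (measurable_of_countable fun v : Fin (k + 1) → ℕ =>
      (∏ j, ((v j).choose (s j) : ℝ)) / (N.choose m : ℝ)).comp hy
    refine Integrable.of_bound hpmeas.aestronglyMeasurable 1 ?_
    filter_upwards [hpsum] with ω hω
    have hp0 : ∀ s, 0 ≤ p s ω := fun s => by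
      simp only [hp]
      positivity
    rw [Real.norm_of_nonneg (hp0 s), ← hω]
    exact Finset.single_le_sum (f := fun s => p s ω) (fun s _ => hp0 s) hs
  have hcase : ∀ ω, ∑ s ∈ S, I s ω = 0 ∨ ((∃ s ∈ S, ∀ j,
      (w ω j : ℤ) = (y ω j : ℤ) + replVecZ k s j) ∧ ∑ s ∈ S, I s ω = 1) := by
    intro ω
    by_cases h : ∃ s ∈ S, ∀ j, (w ω j : ℤ) = (y ω j : ℤ) + replVecZ k s j
    · obtain ⟨s₀, hs₀, h₀⟩ := h
      refine Or.inr ⟨⟨s₀, hs₀, h₀⟩, ?_⟩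
      simpa only [one_mul] using sum_ite_transition hs₀ h₀ fun _ => 1
    · refine Or.inl (Finset.sum_eq_zero fun s hs => ?_)
      exact if_neg fun hs' => h ⟨s, hs, hs'⟩
  have hIsum : ∫ ω, ∑ s ∈ S, I s ω ∂μ = ∫ _, (1 : ℝ) ∂μ := by
    rw [integral_finsetSum _ fun s _ => hIint s, Finset.sum_congr rfl hIp,
      ← integral_finsetSum _ hpint]
    exact integral_congr_ae hpsum
  have hae : ∀ᵐ ω ∂μ, ∃ s ∈ S, ∀ j, (w ω j : ℤ) = (y ω j : ℤ) + replVecZ k s j := by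
    have hle : (fun ω => ∑ s ∈ S, I s ω) ≤ᵐ[μ] fun _ => (1 : ℝ) := by
      refine ae_of_all _ fun ω => ?_
      rcases hcase ω with h | h
      · simp [h]
      · exact h.2.le
    have := (integral_eq_iff_of_ae_le (integrable_finsetSum _ fun s _ => hIint s)
      (integrable_const 1) hle).1 hIsum
    filter_upwards [this] with ω hω
    rcases hcase ω with h | h
    · exact absurd (h.symm.trans hω) zero_ne_one
    · exact h.1
  refine ⟨hae, fun i => ?_⟩
  have hyint : Integrable (fun ω => (y ω i : ℝ)) μ := by
    refine Integrable.of_bound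
      ((measurable_of_countable fun a : ℕ => (a : ℝ)).comp (hyj i)).aestronglyMeasurable N ?_
    filter_upwards [hsum] with ω hω
    rw [Real.norm_of_nonneg (Nat.cast_nonneg _), ← hω]
    exact_mod_cast Finset.single_le_sum (f := y ω) (fun _ _ => Nat.zero_le _) (Finset.mem_univ i)
  calc ∫ ω, (w ω i : ℝ) ∂μ
      = ∫ ω, ((y ω i : ℝ) + ∑ s ∈ S, (replVecZ k s i : ℝ) * I s ω) ∂μ := by
        refine integral_congr_ae ?_
        filter_upwards [hae] with ω hω
        obtain ⟨s₀, hs₀, h₀⟩ := hω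
        simp only [hI]
        rw [sum_ite_transition hs₀ h₀ fun s => (replVecZ k s i : ℝ)]
        exact_mod_cast h₀ i
    _ = ∫ ω, (y ω i : ℝ) ∂μ + ∑ s ∈ S, (replVecZ k s i : ℝ) * ∫ ω, I s ω ∂μ := by
        rw [integral_add hyint (integrable_finsetSum _ fun s _ => (hIint s).const_mul _),
          integral_finsetSum _ fun s _ => (hIint s).const_mul _]
        simp_rw [integral_const_mul]
    _ = ∫ ω, (y ω i : ℝ) ∂μ + ∑ s ∈ S, (replVecZ k s i : ℝ) * ∫ ω, p s ω ∂μ := by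
        congr 1
        exact Finset.sum_congr rfl fun s hs => by rw [hIp s hs]
    _ = ∫ ω, ((y ω i : ℝ) + ∑ s ∈ S, (replVecZ k s i : ℝ) * p s ω) ∂μ := by
        rw [integral_add hyint (integrable_finsetSum _ fun s hs => (hpint s hs).const_mul _),
          integral_finsetSum _ fun s hs => (hpint s hs).const_mul _]
        simp_rw [integral_const_mul]

/-- The mean of one coordinate of the multivariate hypergeometric law. -/
theorem sum_mul_hypergeometric {k m N : ℕ} (hN : 0 < N) (hmN : m ≤ N) {y : Fin (k + 1) → ℕ}
    (hy : ∑ j, y j = N) (j : Fin (k + 1)) :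
    ∑ s ∈ piAntidiag univ m, (s j : ℝ) *
      ((∏ j, ((y j).choose (s j) : ℝ)) / (N.choose m : ℝ)) = m / N * y j := by
  have h := sum_piAntidiag_mul_prod_choose y m j
  have hchoose : (0 : ℝ) < (N.choose m : ℝ) := by exact_mod_cast Nat.choose_pos hmN
  have hN' : (0 : ℝ) < N := by exact_mod_cast hN
  rw [hy] at h
  simp_rw [mul_div_assoc']
  rw [← Finset.sum_div, div_eq_iff hchoose.ne']
  field_simp
  linarith

theorem sum_hypergeometric {k m N : ℕ} (hmN : m ≤ N) {y : Fin (k + 1) → ℕ}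
    (hy : ∑ j, y j = N) :
    ∑ s ∈ piAntidiag univ m, (∏ j, ((y j).choose (s j) : ℝ)) / (N.choose m : ℝ) = 1 := by
  have hchoose : (0 : ℝ) < (N.choose m : ℝ) := by exact_mod_cast Nat.choose_pos hmN
  rw [← Finset.sum_div, sum_piAntidiag_prod_choose, hy, div_self hchoose.ne']

theorem drift_zero {k m N : ℕ} (hN : 0 < N) (hmN : m ≤ N) {y : Fin (k + 1) → ℕ}
    (hy : ∑ j, y j = N) :
    ∑ s ∈ piAntidiag univ m, (replVecZ k s 0 : ℝ) *
      ((∏ j, ((y j).choose (s j) : ℝ)) / (N.choose m : ℝ)) = 1 - m / N * y 0 := by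
  simp only [replVecZ, Fin.val_zero, if_true, Int.cast_sub, Int.cast_one, Int.cast_natCast,
    sub_mul, one_mul, Finset.sum_sub_distrib]
  rw [sum_mul_hypergeometric hN hmN hy, sum_hypergeometric hmN hy]

theorem drift_succ {k m N i : ℕ} (hN : 0 < N) (hmN : m ≤ N) {y : Fin (k + 1) → ℕ}
    (hy : ∑ j, y j = N) (hi : i + 1 < k) :
    ∑ s ∈ piAntidiag univ m, (replVecZ k s ⟨i + 1, by omega⟩ : ℝ) *
      ((∏ j, ((y j).choose (s j) : ℝ)) / (N.choose m : ℝ)) =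
      m / N * y ⟨i, by omega⟩ - m / N * y ⟨i + 1, by omega⟩ := by
  simp only [replVecZ, Nat.add_one_ne_zero, if_false, hi.ne, Nat.add_sub_cancel, Int.cast_sub,
    Int.cast_natCast, sub_mul, Finset.sum_sub_distrib]
  rw [sum_mul_hypergeometric hN hmN hy, sum_mul_hypergeometric hN hmN hy]

/-- For the global containment profile process `(Y_n)` of the
hyperrecursive tree with parameter `θ ≥ 2`, truncated at level `k ≥ 1` (an adapted
`ℕ^{k+1}`-valued process with `Y_0 = (θ, 0, …, 0)` and multivariate-hypergeometric
transition probabilities), the expected number of vertices contained in exactly `i`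
hyperedges satisfies, for every `1 ≤ i ≤ k`,
`E[Y_{n,i}] = ((θ−1)^{i−1}/θ^{i})(n+θ) + O((ln n)^{i−1}/n)` as `n → ∞`.
(Below `i : Fin (k+1)` with `i.val < k` is the 0-indexed version of a level in
`{1, …, k}`, so the exponents `i−1` and `i` become `i.val` and `i.val + 1`.) -/
theorem hyperrecursive_profile_mean_asymptotics
    {Ω : Type*} {m0 : MeasurableSpace Ω} {μ : Measure Ω} [IsProbabilityMeasure μ]
    (θ k : ℕ) (hθ : 2 ≤ θ) (hk : 1 ≤ k)
    (F : ℕ → MeasurableSpace Ω) (hFle : ∀ n, F n ≤ m0) (hFmono : Monotone F)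
    (Y : ℕ → Ω → Fin (k + 1) → ℕ)
    (hYadapted : ∀ n, Measurable[F n] (Y n))
    (hY0 : ∀ ω, Y 0 ω = fun i => if i.val = 0 then θ else 0)
    (hcond : ∀ n, 1 ≤ n → ∀ s : Fin (k + 1) → ℕ, (∑ i, s i = θ - 1) →
      (μ[(fun ω => if (∀ j : Fin (k + 1),
            (Y n ω j : ℤ) = (Y (n - 1) ω j : ℤ) + replVecZ k s j)
          then (1 : ℝ) else 0) | F (n - 1)]) =ᵐ[μ]
        (fun ω => (∏ j, ((Y (n - 1) ω j).choose (s j) : ℝ)) /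
          ((n - 1 + θ).choose (θ - 1) : ℝ))) :
    ∀ i : Fin (k + 1), i.val < k →
      (fun n : ℕ => (∫ ω, (Y n ω i : ℝ) ∂μ) -
          (((θ : ℝ) - 1) ^ i.val / (θ : ℝ) ^ (i.val + 1)) * ((n : ℝ) + θ))
        =O[atTop] (fun n : ℕ => (Real.log n) ^ i.val / (n : ℝ)) := by
  have hYm : ∀ n, Measurable (Y n) := fun n => (hYadapted n).mono (hFle n) le_rfl
  have hstep : ∀ n, (∀ᵐ ω ∂μ, ∑ j, Y n ω j = n + θ) → _ := fun n hn =>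
    transition_ae_and_integral (N := n + θ) (m := θ - 1) (by omega) (hYm n) (hYm (n + 1)) hn
      fun s hs => by
        have h := hcond (n + 1) (by omega) s hs
        simp only [Nat.add_sub_cancel] at h
        rw [← integral_condExp (hFle n)]
        exact integral_congr_ae h
  have htot : ∀ n, ∀ᵐ ω ∂μ, ∑ j, Y n ω j = n + θ := by
    intro n
    induction n with
    | zero =>
      refine ae_of_all _ fun ω => ?_
      rw [hY0, Fin.sum_univ_succ]
      simp
    | succ n ih =>
      filter_upwards [ih, (hstep n ih).1] with ω hω h
      obtain ⟨s, -, hs⟩ := h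
      have h1 : ∑ j, (Y (n + 1) ω j : ℤ) = ∑ j, (Y n ω j : ℤ) + 1 := by
        rw [← sum_replVecZ hk s, ← Finset.sum_add_distrib]
        exact Finset.sum_congr rfl fun j _ => hs j
      have h2 : ((∑ j, Y (n + 1) ω j : ℕ) : ℤ) = ((∑ j, Y n ω j : ℕ) : ℤ) + 1 := by
        push_cast
        exact h1
      omega
  have hint : ∀ n i, Integrable (fun ω => (Y n ω i : ℝ)) μ := by
    intro n i
    refine Integrable.of_bound ((measurable_of_countable fun a : ℕ => (a : ℝ)).comp
      ((measurable_pi_apply i).comp (hYm n))).aestronglyMeasurable (n + θ : ℕ) ?_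
    filter_upwards [htot n] with ω hω
    rw [Real.norm_of_nonneg (Nat.cast_nonneg _), ← hω]
    exact_mod_cast Finset.single_le_sum (f := Y n ω) (fun _ _ => Nat.zero_le _) (Finset.mem_univ i)
  have hθ' : ((θ - 1 : ℕ) : ℝ) = (θ : ℝ) - 1 := by
    rw [Nat.cast_sub (by omega), Nat.cast_one]
  let M : ℕ → ℕ → ℝ := fun n i => if h : i < k then ∫ ω, (Y n ω ⟨i, by omega⟩ : ℝ) ∂μ else 0
  have hM : ∀ n i (h : i < k), M n i = ∫ ω, (Y n ω ⟨i, by omega⟩ : ℝ) ∂μ := fun n i h => dif_pos h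
  have hbound := mean_error_bound (t := θ) (by exact_mod_cast hθ) (k := k) (m := M)
    (by
      intro i hi
      rw [hM 0 i hi]
      simp only [hY0]
      split_ifs <;> simp)
    (by
      intro n
      rw [hM _ 0 hk, hM _ 0 hk]
      change ∫ ω, (Y (n + 1) ω 0 : ℝ) ∂μ = _ * ∫ ω, (Y n ω 0 : ℝ) ∂μ + 1
      rw [(hstep n (htot n)).2 0]
      have : ∀ᵐ ω ∂μ, ((Y n ω 0 : ℝ) + ∑ s ∈ piAntidiag univ (θ - 1), (replVecZ k s 0 : ℝ) *
          ((∏ j, ((Y n ω j).choose (s j) : ℝ)) / ((n + θ).choose (θ - 1) : ℝ))) =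
          (1 - ((θ : ℝ) - 1) / (n + θ)) * Y n ω 0 + 1 := by
        filter_upwards [htot n] with ω hω
        rw [drift_zero (by omega) (by omega) hω, hθ']
        push_cast
        ring
      rw [integral_congr_ae this, integral_add ((hint n 0).const_mul _) (integrable_const 1),
        integral_const_mul]
      simp)
    (by
      intro n i hi
      rw [hM _ (i + 1) hi, hM _ (i + 1) hi, hM _ i (by omega), (hstep n (htot n)).2]
      have : ∀ᵐ ω ∂μ, ((Y n ω ⟨i + 1, by omega⟩ : ℝ) + ∑ s ∈ piAntidiag univ (θ - 1),
          (replVecZ k s ⟨i + 1, by omega⟩ : ℝ) *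
          ((∏ j, ((Y n ω j).choose (s j) : ℝ)) / ((n + θ).choose (θ - 1) : ℝ))) =
          (1 - ((θ : ℝ) - 1) / (n + θ)) * Y n ω ⟨i + 1, by omega⟩ +
            ((θ : ℝ) - 1) / (n + θ) * Y n ω ⟨i, by omega⟩ := by
        filter_upwards [htot n] with ω hω
        rw [drift_succ (by omega) (by omega) hω hi, hθ']
        push_cast
        ring
      rw [integral_congr_ae this, integral_add ((hint n _).const_mul _) ((hint n _).const_mul _),
        integral_const_mul, integral_const_mul])
  intro i hi
  have hθ1 : (0 : ℝ) ≤ (θ : ℝ) - 1 := by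
    rw [← hθ']
    positivity
  refine isBigO_log_pow_div_of_harmonic_bound (C := ((θ : ℝ) - 1) ^ (i.val + 1))
    (by positivity) fun n => ?_
  have := hbound i.val hi n
  rwa [hM n i.val hi] at this
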